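/- arXiv:2310.15168 — 2 statements merged into one kernel-verified Lean document; each statement's English description precedes it below -/
import Mathlib

section
/- For every compact topological 2-manifold with boundary M (Hausdorff and second countable), there exist a compact topological 2-manifold N without boundary (Hausdorff and second countable) and a closed topological embedding of M into N. -/
open Set Topology Metric

/-- There is no continuous branch of the logarithm on a circle around the origin. -/
theorem Complex.not_exists_continuousOn_log_sphere {r : ℝ} (hr : 0 < r) {L : ℂ → ℂ}
    (hL : ContinuousOn L (sphere 0 r)) (h : ∀ z ∈ sphere (0 : ℂ) r, Complex.exp (L z) = z) :
    False := by
  have hmem (t : ℝ) : circleMap 0 r t ∈ sphere (0 : ℂ) r := circleMap_mem_sphere 0 hr.le t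
  let g : ℝ → ℂ := fun t ↦ L (circleMap 0 r t) - t * Complex.I
  have hg : Continuous fun t : ℝ ↦ L (circleMap 0 r t) - t * Complex.I := by
    have : Continuous fun t : ℝ ↦ L (circleMap 0 r t) :=
      hL.comp_continuous (continuous_circleMap 0 r) hmem
    exact this.sub (by fun_prop)
  have hexp (t : ℝ) : Complex.exp (g t) = r := by
    simp only [g]
    rw [Complex.exp_sub, h _ (hmem t), circleMap, zero_add, mul_div_cancel_right₀]
    exact Complex.exp_ne_zero _
  have key := Complex.isCoveringMap_exp.const_of_comp hg
    (fun a b ↦ Subtype.ext ((hexp a).trans (hexp b).symm)) (2 * Real.pi) 0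
  have hper : circleMap 0 r (2 * Real.pi) = circleMap 0 r 0 := by
    simpa using periodic_circleMap 0 r 0
  simp [hper] at key

theorem EuclideanHalfSpace.isSimplyConnected_puncturedBall {p : EuclideanHalfSpace 2}
    (hp : p.1 0 = 0) {δ : ℝ} (hδ : 0 < δ) :
    IsSimplyConnected {x : EuclideanHalfSpace 2 | x.1 ∈ ball p.1 δ ∧ x ≠ p} := by
  rw [← Topology.IsEmbedding.subtypeVal.isSimplyConnected_image]
  set S : Set (EuclideanSpace ℝ (Fin 2)) :=
    Subtype.val '' {x : EuclideanHalfSpace 2 | x.1 ∈ ball p.1 δ ∧ x ≠ p}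
  have hSmem (v : EuclideanSpace ℝ (Fin 2)) : v ∈ S ↔ 0 ≤ v 0 ∧ v ∈ ball p.1 δ ∧ v ≠ p.1 := by
    constructor
    · rintro ⟨x, ⟨hx, hxp⟩, rfl⟩
      exact ⟨x.2, hx, fun h ↦ hxp (Subtype.ext h)⟩
    · rintro ⟨h0, h1, h2⟩
      exact ⟨⟨v, h0⟩, ⟨h1, fun h ↦ h2 (congrArg Subtype.val h)⟩, rfl⟩
  let q : EuclideanSpace ℝ (Fin 2) := p.1 + EuclideanSpace.single 0 (δ / 2)
  have hq0 : q 0 = δ / 2 := by simp [q, hp]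
  have hqb : q ∈ ball p.1 δ := by
    simp [q, abs_of_pos hδ]; linarith
  have hstar : StarConvex ℝ q S := by
    intro y hy a b ha hb hab
    rw [hSmem] at hy ⊢
    have h0 : (a • q + b • y) 0 = a * (δ / 2) + b * y 0 := by simp [hq0]
    have hby := mul_nonneg hb hy.1
    refine ⟨by rw [h0]; positivity, convex_ball p.1 δ hqb hy.2.1 ha hb hab, fun he ↦ ?_⟩
    rw [he, hp] at h0
    obtain rfl : a = 0 := by nlinarith
    obtain rfl : b = 1 := by linarith
    exact hy.2.2 (by simpa using he)
  have hqS : q ∈ S := (hSmem q).2 ⟨by rw [hq0]; positivity, hqb, fun h ↦ by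
    rw [h, hp] at hq0; linarith⟩
  have := hstar.contractibleSpace ⟨q, hqS⟩
  exact SimplyConnectedSpace.ofContractible S

/-- Invariance of the boundary in dimension two: a point of the half-plane with a planar
neighbourhood does not lie on the boundary line. -/
theorem EuclideanHalfSpace.apply_zero_pos_of_mem_source
    (e : OpenPartialHomeomorph (EuclideanHalfSpace 2) (EuclideanSpace ℝ (Fin 2)))
    {p : EuclideanHalfSpace 2} (hp : p ∈ e.source) : 0 < p.1 0 := by
  refine lt_of_le_of_ne p.2 fun hp0 ↦ ?_
  let J : EuclideanSpace ℝ (Fin 2) ≃ₗᵢ[ℝ] ℂ := Complex.orthonormalBasisOneI.repr.symm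
  obtain ⟨t, ht, hts⟩ := isOpen_induced_iff.1 e.open_source
  obtain ⟨δ, hδ, hball⟩ := Metric.isOpen_iff.1 ht p.1 (by rw [← hts] at hp; exact hp)
  set U := {x : EuclideanHalfSpace 2 | x.1 ∈ ball p.1 δ ∧ x ≠ p}
  have hUs : U ⊆ e.source := fun x hx ↦ by rw [← hts]; exact hball hx.1
  have hBo : IsOpen {x : EuclideanHalfSpace 2 | x.1 ∈ ball p.1 δ} :=
    isOpen_ball.preimage continuous_subtype_val
  have : T2Space (EuclideanHalfSpace 2) :=
    inferInstanceAs (T2Space {x : EuclideanSpace ℝ (Fin 2) // 0 ≤ x 0})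
  have hUo : IsOpen U := hBo.inter isOpen_ne
  obtain ⟨f, hf, hfe⟩ := Complex.exists_continuousOn_eqOn_exp_comp
    (isSimplyConnected_puncturedBall hp0.symm hδ) hUo (g := fun x ↦ J (e x - e p))
    (J.continuous.comp_continuousOn ((e.continuousOn.mono hUs).sub continuousOn_const))
    (by
      rintro ⟨x, hx, h0⟩
      simp only [map_eq_zero_iff J J.injective, sub_eq_zero] at h0
      exact hx.2 (e.injOn (hUs hx) hp h0))
  let k : ℂ → EuclideanSpace ℝ (Fin 2) := fun z ↦ e p + J.symm z
  have hk : Continuous k := by fun_prop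
  have hk0 : k 0 = e p := by simp [k]
  have hnhds : ∀ᶠ z in 𝓝 (0 : ℂ), k z ∈ e.target ∧ (e.symm (k z)).1 ∈ ball p.1 δ := by
    have h1 := hk.continuousAt.preimage_mem_nhds (x := 0)
      (t := e.target ∩ e.symm ⁻¹' {x | x.1 ∈ ball p.1 δ}) ?_
    · exact h1
    · refine (e.isOpen_inter_preimage_symm hBo).mem_nhds ?_
      rw [hk0]
      exact ⟨e.map_source hp, by simp [e.left_inv hp, hδ]⟩
  obtain ⟨r, hr, hrb⟩ := Metric.nhds_basis_closedBall.eventually_iff.1 hnhds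
  have hsph (z : ℂ) (hz : z ∈ sphere (0 : ℂ) r) : k z ∈ e.target ∧ e.symm (k z) ∈ U := by
    obtain ⟨h1, h2⟩ := hrb (sphere_subset_closedBall hz)
    refine ⟨h1, h2, fun h ↦ ?_⟩
    have := e.right_inv h1
    rw [h] at this
    have hz0 : z = 0 := by simpa [k] using this
    simp [hz0] at hz
    linarith
  refine Complex.not_exists_continuousOn_log_sphere hr (L := fun z ↦ f (e.symm (k z))) ?_ ?_
  · exact hf.comp (e.symm.continuousOn.comp hk.continuousOn fun z hz ↦ (hsph z hz).1)
      fun z hz ↦ (hsph z hz).2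
  · intro z hz
    refine (hfe (hsph z hz).2).trans ?_
    simp [e.right_inv (hsph z hz).1, k]

/-- `y` with its sign reversed when `s` is negative. -/
noncomputable def signFlip (s y : ℝ) : ℝ := if 0 ≤ s then y else -y

theorem abs_signFlip (s y : ℝ) : |signFlip s y| = |y| := by
  unfold signFlip; split_ifs <;> simp

theorem ContinuousOn.signFlip {X : Type*} [TopologicalSpace X] {f g : X → ℝ} {s : Set X}
    (hg : ContinuousOn g s) (hf : ContinuousOn f s) (h : ∀ x ∈ s, g x = 0 → f x = 0) :
    ContinuousOn (fun x ↦ signFlip (g x) (f x)) s := by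
  intro x hx
  rcases lt_trichotomy (g x) 0 with hlt | heq | hgt
  · refine (hf x hx).neg.congr_of_eventuallyEq ?_ (by simp [_root_.signFlip, hlt.not_ge])
    filter_upwards [(hg x hx).eventually (gt_mem_nhds hlt)] with y hy
    simp [_root_.signFlip, hy.not_ge]
  · have h0 := h x hx heq
    have hlim := (hf x hx).abs
    simp only [ContinuousWithinAt, h0, abs_zero] at hlim
    simp only [ContinuousWithinAt, h0, _root_.signFlip, neg_zero, ite_self]
    exact squeeze_zero_norm (fun y ↦ (abs_signFlip (g y) (f y)).le) hlim
  · refine (hf x hx).congr_of_eventuallyEq ?_ (by simp [_root_.signFlip, hgt.le])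
    filter_upwards [(hg x hx).eventually (lt_mem_nhds hgt)] with y hy
    simp [_root_.signFlip, hy.le]

namespace EuclideanHalfSpace

/-- The map folding the plane onto the half-plane along the boundary line. -/
noncomputable def fold (v : EuclideanSpace ℝ (Fin 2)) : EuclideanHalfSpace 2 :=
  ⟨!₂[|v 0|, v 1], by simp⟩

theorem fold_apply_zero (v : EuclideanSpace ℝ (Fin 2)) : (fold v).1 0 = |v 0| := by simp [fold]

theorem fold_apply_one (v : EuclideanSpace ℝ (Fin 2)) : (fold v).1 1 = v 1 := by simp [fold]

theorem fold_signFlip (t : ℝ) (x : EuclideanHalfSpace 2) :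
    fold !₂[signFlip t (x.1 0), x.1 1] = x := by
  ext i
  fin_cases i
  · simpa [fold, abs_signFlip] using x.2
  · simp [fold]

theorem continuous_fold : Continuous fold :=
  Continuous.subtype_mk (by
    refine (PiLp.continuous_toLp 2 _).comp (continuous_pi fun i ↦ ?_)
    fin_cases i <;> simp <;> fun_prop) _

theorem continuous_apply (i : Fin 2) : Continuous fun x : EuclideanHalfSpace 2 ↦ x.1 i :=
  (EuclideanSpace.proj (𝕜 := ℝ) i).continuous.comp continuous_subtype_val

/-- The inclusion of the open half-plane into the plane. -/
noncomputable def interiorChart :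
    OpenPartialHomeomorph (EuclideanHalfSpace 2) (EuclideanSpace ℝ (Fin 2)) where
  toFun := Subtype.val
  invFun := fold
  source := {x | 0 < x.1 0}
  target := {v | 0 < v 0}
  map_source' _ hx := hx
  map_target' v hv := by simpa [fold_apply_zero] using hv.ne'
  left_inv' x hx := by
    ext i
    fin_cases i
    · simpa [fold] using (show 0 < x.1 0 from hx).le
    · simp [fold]
  right_inv' v hv := by
    ext i
    fin_cases i
    · simpa [fold] using (show 0 < v 0 from hv).le
    · simp [fold]
  open_source := isOpen_lt continuous_const (continuous_apply 0)
  open_target := isOpen_lt continuous_const (EuclideanSpace.proj (𝕜 := ℝ) (0 : Fin 2)).continuous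
  continuousOn_toFun := continuous_subtype_val.continuousOn
  continuousOn_invFun := continuous_fold.continuousOn

end EuclideanHalfSpace

/-- The points of a space having a neighbourhood homeomorphic to an open subset of the plane. -/
def planarPoints (M : Type*) [TopologicalSpace M] : Set M :=
  {x | ∃ e : OpenPartialHomeomorph M (EuclideanSpace ℝ (Fin 2)), x ∈ e.source}

theorem isOpen_planarPoints (M : Type*) [TopologicalSpace M] : IsOpen (planarPoints M) :=
  isOpen_iff_mem_nhds.2 fun _ ⟨e, he⟩ ↦
    Filter.mem_of_superset (e.open_source.mem_nhds he) fun _ hy ↦ ⟨e, hy⟩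

theorem mem_planarPoints_iff {M : Type*} [TopologicalSpace M]
    (φ : OpenPartialHomeomorph M (EuclideanHalfSpace 2)) {x : M} (hx : x ∈ φ.source) :
    x ∈ planarPoints M ↔ 0 < (φ x).1 0 := by
  constructor
  · rintro ⟨e, he⟩
    exact EuclideanHalfSpace.apply_zero_pos_of_mem_source (φ.symm.trans e)
      (by simp [φ.map_source hx, φ.left_inv hx, he])
  · intro h
    exact ⟨φ.trans EuclideanHalfSpace.interiorChart, by
      simpa [hx] using (show φ x ∈ EuclideanHalfSpace.interiorChart.source from h)⟩

/-- The double of a space along the zero set of a nonnegative function, realised as the union of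
the graphs of the function and of its negative. -/
def graphDouble {M : Type*} [TopologicalSpace M] (d : C(M, ℝ)) : Set (M × ℝ) :=
  {p | |p.2| = d p.1}

namespace graphDouble

variable {M : Type*} [TopologicalSpace M] {d : C(M, ℝ)}

theorem isClosed (d : C(M, ℝ)) : IsClosed (graphDouble d) :=
  isClosed_eq (by fun_prop) (by fun_prop)

instance [CompactSpace M] (d : C(M, ℝ)) : CompactSpace (graphDouble d) := by
  obtain ⟨C, hC⟩ := (isCompact_range d.continuous).bddAbove
  have hK : IsCompact ((univ : Set M) ×ˢ Icc (-C) C) := isCompact_univ.prod isCompact_Icc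
  refine isCompact_iff_compactSpace.1 (hK.of_isClosed_subset (isClosed d) ?_)
  rintro ⟨x, t⟩ (h : |t| = d x)
  exact ⟨mem_univ _, abs_le.1 (h.trans_le (hC (mem_range_self x)))⟩

/-- The section of the double picking the graph of the function. -/
def upper (hd : ∀ x, 0 ≤ d x) (x : M) : graphDouble d := ⟨(x, d x), abs_of_nonneg (hd x)⟩

theorem isClosedEmbedding_upper [T2Space M] [CompactSpace M] (hd : ∀ x, 0 ≤ d x) :
    IsClosedEmbedding (upper hd) :=
  Continuous.isClosedEmbedding (Continuous.subtype_mk (by fun_prop) _)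
    fun x y h ↦ congrArg (fun p ↦ p.1.1) h

theorem prodMk_mul_mem (hd : ∀ x, 0 ≤ d x) {c : ℝ} (hc : |c| = 1) (x : M) :
    (x, c * d x) ∈ graphDouble d := by
  simp [graphDouble, abs_mul, hc, abs_of_nonneg (hd x)]

/-- Each open half of the double projects homeomorphically to the set where the function is
positive. -/
noncomputable def sideChart (hd : ∀ x, 0 ≤ d x) (c : ℝ) (hc : |c| = 1) :
    OpenPartialHomeomorph (graphDouble d) M where
  toFun p := p.1.1
  invFun x := ⟨(x, c * d x), prodMk_mul_mem hd hc x⟩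
  source := {p | 0 < c * p.1.2}
  target := {x | 0 < d x}
  map_source' := by
    rintro ⟨⟨x, t⟩, h⟩ ht
    change 0 < c * t at ht
    exact (abs_pos.2 (right_ne_zero_of_mul ht.ne')).trans_eq h
  map_target' x hx := by
    have : c * c = 1 := by rw [← abs_mul_abs_self, hc, one_mul]
    simpa [← mul_assoc, this] using hx
  left_inv' := by
    rintro ⟨⟨x, t⟩, h'⟩ ht
    change |t| = d x at h'
    change 0 < c * t at ht
    have : c * c = 1 := by rw [← abs_mul_abs_self, hc, one_mul]
    refine Subtype.ext (Prod.ext rfl ?_)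
    change c * d x = t
    rw [← h', ← one_mul |t|, ← hc, ← abs_mul, abs_of_pos ht, ← mul_assoc, this, one_mul]
  right_inv' _ _ := rfl
  open_source := isOpen_lt continuous_const
    (continuous_const.mul (continuous_snd.comp continuous_subtype_val))
  open_target := isOpen_lt continuous_const d.continuous
  continuousOn_toFun := (continuous_fst.comp continuous_subtype_val).continuousOn
  continuousOn_invFun :=
    (continuous_id.prodMk (continuous_const.mul d.continuous)).subtype_mk _ |>.continuousOn

open EuclideanHalfSpace in
/-- The planar chart of the double obtained by reflecting a half-plane chart whose boundary points
are exactly the zeros of the function. -/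
noncomputable def unfoldChart (hd : ∀ x, 0 ≤ d x)
    (φ : OpenPartialHomeomorph M (EuclideanHalfSpace 2))
    (hφ : ∀ x ∈ φ.source, d x = 0 ↔ (φ x).1 0 = 0) :
    OpenPartialHomeomorph (graphDouble d) (EuclideanSpace ℝ (Fin 2)) where
  toFun p := !₂[signFlip p.1.2 ((φ p.1.1).1 0), (φ p.1.1).1 1]
  invFun v := ⟨(φ.symm (fold v), signFlip (v 0) (d (φ.symm (fold v)))), by
    simp [graphDouble, abs_signFlip, abs_of_nonneg (hd _)]⟩
  source := {p | p.1.1 ∈ φ.source}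
  target := {v | fold v ∈ φ.target}
  map_source' := by
    rintro ⟨⟨x, t⟩, h⟩ hx
    have := fold_signFlip t (φ x)
    simpa [this] using φ.map_source hx
  map_target' v hv := φ.map_target hv
  left_inv' := by
    rintro ⟨⟨x, t⟩, h : |t| = d x⟩ (hx : x ∈ φ.source)
    have := fold_signFlip t (φ x)
    ext
    · simp [this, φ.left_inv hx]
    · simp only [this, φ.left_inv hx]
      have h0 := (φ x).2
      rcases le_or_gt 0 t with ht | ht
      · simp [signFlip, ht, h0, ← h, abs_of_nonneg]
      · have hne : (φ x).1 0 ≠ 0 := fun h' ↦ by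
          rw [← hφ x hx, ← h, abs_eq_zero] at h'
          exact ht.ne h'
        have hpos := lt_of_le_of_ne h0 hne.symm
        simp [signFlip, ht.not_ge, hpos.not_ge, ← h, abs_of_neg ht]
  right_inv' v hv := by
    have hφx := hφ _ (φ.map_target hv)
    rw [φ.right_inv hv, fold_apply_zero, abs_eq_zero] at hφx
    ext i
    fin_cases i
    · simp only [φ.right_inv hv, fold_apply_zero]
      rcases le_or_gt 0 (v 0) with h | h
      · simp [signFlip, h, hd, abs_of_nonneg]
      · have hne := lt_of_le_of_ne (hd _) (Ne.symm (mt hφx.1 h.ne))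
        simp [signFlip, h.not_ge, hne.not_ge, abs_of_neg h]
    · simp [φ.right_inv hv, fold_apply_one]
  open_source := φ.open_source.preimage (by fun_prop)
  open_target := φ.open_target.preimage continuous_fold
  continuousOn_toFun := by
    have hφc : ContinuousOn (fun p : graphDouble d ↦ φ p.1.1) {p | p.1.1 ∈ φ.source} :=
      φ.continuousOn.comp (by fun_prop) fun _ h ↦ h
    refine (PiLp.continuous_toLp 2 _).comp_continuousOn (continuousOn_pi.2 fun i ↦ ?_)
    fin_cases i
    · refine ContinuousOn.signFlip (by fun_prop) ((continuous_apply 0).comp_continuousOn hφc) ?_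
      rintro ⟨⟨x, t⟩, h : |t| = d x⟩ hx (rfl : t = 0)
      exact (hφ x hx).1 (by simp [← h])
    · exact (continuous_apply 1).comp_continuousOn hφc
  continuousOn_invFun := by
    have hc : ContinuousOn (fun v ↦ φ.symm (fold v)) {v | fold v ∈ φ.target} :=
      φ.symm.continuousOn.comp continuous_fold.continuousOn fun _ h ↦ h
    refine Topology.IsInducing.subtypeVal.continuousOn_iff.2 (hc.prodMk ?_)
    refine ContinuousOn.signFlip (by fun_prop) (d.continuous.comp_continuousOn hc) fun v hv h0 ↦ ?_
    refine (hφ _ (φ.map_target hv)).2 ?_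
    rw [φ.right_inv hv, fold_apply_zero, h0, abs_zero]

/-- The double of a surface with boundary along its boundary is locally planar. -/
theorem planarPoints_eq_univ [ChartedSpace (EuclideanHalfSpace 2) M] (hd : ∀ x, 0 ≤ d x)
    (h0 : ∀ x, d x = 0 ↔ x ∉ planarPoints M) : planarPoints (graphDouble d) = univ := by
  refine eq_univ_of_forall ?_
  rintro ⟨⟨x, t⟩, h⟩
  have h' : |t| = d x := h
  by_cases ht : t = 0
  · refine ⟨unfoldChart hd (chartAt (EuclideanHalfSpace 2) x) fun y hy ↦ ?_,
      mem_chart_source (EuclideanHalfSpace 2) x⟩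
    rw [h0, mem_planarPoints_iff _ hy, not_lt]
    exact ⟨fun h ↦ le_antisymm h (chartAt (EuclideanHalfSpace 2) x y).2, fun h ↦ h.le⟩
  · have hx : d x ≠ 0 := by rwa [← h', Ne, abs_eq_zero]
    obtain ⟨e, he⟩ := not_not.1 (mt (h0 x).2 hx)
    obtain ⟨c, hc, hct⟩ : ∃ c : ℝ, |c| = 1 ∧ 0 < c * t := by
      rcases lt_or_gt_of_ne ht with ht | ht
      · exact ⟨-1, by simp, by linarith⟩
      · exact ⟨1, by simp, by linarith⟩
    exact ⟨(sideChart hd c hc).trans e, hct, he⟩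

end graphDouble


/-- Every compact topological 2-manifold with boundary (Hausdorff and second countable)
admits a closed topological embedding into some compact topological 2-manifold without
boundary (Hausdorff and second countable). -/
theorem compact_bordered_surface_closedEmbedding_closed_surface
    (M : Type) [TopologicalSpace M] [ChartedSpace (EuclideanHalfSpace 2) M]
    [T2Space M] [SecondCountableTopology M] [CompactSpace M] :
    ∃ (N : Type) (_ : TopologicalSpace N) (_ : ChartedSpace (EuclideanSpace ℝ (Fin 2)) N),
      T2Space N ∧ SecondCountableTopology N ∧ CompactSpace N ∧
      ∃ f : M → N, Topology.IsClosedEmbedding f := by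
  obtain ⟨d, hdz, hd⟩ := perfectlyNormalSpace_iff_forall_isClosed_preimage_zero.1
    (inferInstance : PerfectlyNormalSpace M) _ (isOpen_planarPoints M).isClosed_compl
  have hN := graphDouble.planarPoints_eq_univ (fun x ↦ (hd x).1) fun x ↦
    (Set.ext_iff.1 hdz x).symm
  choose e he using eq_univ_iff_forall.1 hN
  exact ⟨graphDouble d, inferInstance,
    { atlas := range e
      chartAt := e
      mem_chart_source := he
      chart_mem_atlas := mem_range_self },
    inferInstance, inferInstance, inferInstance, _,
    graphDouble.isClosedEmbedding_upper fun x ↦ (hd x).1⟩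
end

section
/- Let V be a real vector space, let u₁, u₂ ∈ V, and let s₁, s₂ ∈ ℝ with s₁ > 0 > s₂. For SDF values a, b with a ≠ b define u(a, b) := (b − a)⁻¹ • (b • u₁ − a • u₂). Then for every ε ∈ ℝ, u(s₁ + ε, s₂ + ε) − u(s₁, s₂) = (ε / (|s₁| + |s₂|)) • (u₂ − u₁). -/
/-- Effect of adding an identical noise `ε` to both SDF values `s₁ > 0 > s₂`: the
extracted vertex `u(a, b) = (b - a)⁻¹ • (b • u₁ - a • u₂)` is displaced by
`(ε / (|s₁| + |s₂|)) • (u₂ - u₁)`. -/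
theorem extracted_vertex_noise_displacement
    (V : Type*) [AddCommGroup V] [Module ℝ V]
    (u₁ u₂ : V) (s₁ s₂ : ℝ) (h₁ : 0 < s₁) (h₂ : s₂ < 0)
    (u : ℝ → ℝ → V) (hu : ∀ a b : ℝ, a ≠ b → u a b = (b - a)⁻¹ • (b • u₁ - a • u₂)) :
    ∀ ε : ℝ, u (s₁ + ε) (s₂ + ε) - u s₁ s₂ = (ε / (|s₁| + |s₂|)) • (u₂ - u₁) := by
  intro ε
  have hd : s₁ - s₂ ≠ 0 := by linarith
  have hinv : (s₂ - s₁)⁻¹ = -(s₁ - s₂)⁻¹ := by rw [← neg_sub s₁ s₂, inv_neg]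
  rw [hu _ _ (by linarith), hu _ _ (by linarith), abs_of_pos h₁, abs_of_neg h₂,
    add_sub_add_right_eq_sub, hinv, ← sub_eq_add_neg, div_eq_mul_inv]
  module
end
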